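/- arXiv:1711.04265 — 3 statements merged into one kernel-verified Lean document; each statement's English description precedes it below -/
import Mathlib

section
/- Let x = (x_n) be a real sequence such that every ordinary limit point of x is also a statistical cluster point of x, i.e., Γ_x = L_x. Then the set {ω ∈ (0,1] : Γ_x = Γ_{x↾ω}} is comeager in (0,1]. -/
open Filter Set Topology
open scoped Classical

/-- Upper asymptotic density `d*(X) = limsup_{n→∞} |X ∩ [1,n]| / n`. -/
noncomputable def upperDensity (X : Set ℕ) : ℝ :=
  Filter.limsup
    (fun n : ℕ => (((Finset.Icc 1 n).filter (fun i => i ∈ X)).card : ℝ) / n)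
    Filter.atTop

/-- `ℓ` is an ordinary limit point of `x`: some subsequence converges to `ℓ`. -/
def IsLimitPt (x : ℕ → ℝ) (ℓ : ℝ) : Prop :=
  ∃ φ : ℕ → ℕ, StrictMono φ ∧
    Filter.Tendsto (fun k => x (φ k)) Filter.atTop (nhds ℓ)

/-- `L_x`, the set of ordinary limit points of `x`. -/
def limitPts (x : ℕ → ℝ) : Set ℝ := {ℓ | IsLimitPt x ℓ}

/-- `ℓ` is a statistical cluster point of `x`. -/
def IsStatClusterPt (x : ℕ → ℝ) (ℓ : ℝ) : Prop :=
  ∀ ε : ℝ, 0 < ε → 0 < upperDensity {n : ℕ | |x n - ℓ| ≤ ε}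

/-- `Γ_x`, the set of statistical cluster points of `x`. -/
def statClusterPts (x : ℕ → ℝ) : Set ℝ := {ℓ | IsStatClusterPt x ℓ}

/-- `ℓ` is a statistical limit point of `x`: some subsequence along an index set
of positive upper density converges to `ℓ`. -/
def IsStatLimitPt (x : ℕ → ℝ) (ℓ : ℝ) : Prop :=
  ∃ φ : ℕ → ℕ, StrictMono φ ∧
    Filter.Tendsto (fun k => x (φ k)) Filter.atTop (nhds ℓ) ∧
    0 < upperDensity (Set.range φ)

/-- `Λ_x`, the set of statistical limit points of `x`. -/
def statLimitPts (x : ℕ → ℝ) : Set ℝ := {ℓ | IsStatLimitPt x ℓ}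

/-- The `n`-th binary digit (`n ≥ 1`) of `ω ∈ (0,1]` in the unique binary
representation of `ω` having infinitely many digits equal to `1`:
the partial sums of that representation are `s_N = (⌈2^N ω⌉ - 1)/2^N`. -/
noncomputable def binDigit (ω : ℝ) (n : ℕ) : ℤ :=
  ⌈(2 : ℝ) ^ n * ω⌉ - 2 * ⌈(2 : ℝ) ^ (n - 1) * ω⌉ + 1

/-- The set of indices `n ≥ 1` with `d_n(ω) = 1`. -/
def digitOneSet (ω : ℝ) : Set ℕ := {n | 1 ≤ n ∧ binDigit ω n = 1}

/-- The subsequence `x↾ω` of `x` obtained by choosing, in increasing order,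
all indices `n` with `d_n(ω) = 1`. -/
noncomputable def subseq (x : ℕ → ℝ) (ω : ℝ) : ℕ → ℝ :=
  fun k => x (Nat.nth (fun n => n ∈ digitOneSet ω) k)

/-- `q_{ω,m}(N)`: the proportion, among the first `N` terms of `x↾ω`,
of those within `1/m` of `ℓ`. -/
noncomputable def qdens (x : ℕ → ℝ) (ℓ : ℝ) (ω : ℝ) (m N : ℕ) : ℝ :=
  (((Finset.range N).filter (fun i => |subseq x ω i - ℓ| ≤ 1 / m)).card : ℝ) / N

lemma isLimitPt_iff_frequently (x : ℕ → ℝ) (ℓ : ℝ) :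
    IsLimitPt x ℓ ↔ ∀ ε : ℝ, 0 < ε → ∃ᶠ n in atTop, |x n - ℓ| ≤ ε := by
  constructor
  · rintro ⟨φ, hφ, hlim⟩ ε hε
    have hev : ∀ᶠ k in atTop, |x (φ k) - ℓ| ≤ ε := by
      filter_upwards [hlim.eventually (Metric.ball_mem_nhds ℓ hε)] with k hk
      exact (Real.dist_eq _ _ ▸ Metric.mem_ball.1 hk).le
    exact hφ.tendsto_atTop.frequently hev.frequently
  · intro H
    refine MapClusterPt.tendsto_subseq ?_
    rw [mapClusterPt_iff_frequently]
    intro s hs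
    obtain ⟨ε, hε, hball⟩ := Metric.mem_nhds_iff.1 hs
    refine (H (ε / 2) (half_pos hε)).mono fun n hn => hball ?_
    rw [Metric.mem_ball, Real.dist_eq]
    linarith

lemma upperDensity_eq_zero_of_finite {X : Set ℕ} (hX : X.Finite) : upperDensity X = 0 := by
  refine Tendsto.limsup_eq ?_
  refine squeeze_zero (fun n => by positivity) (fun n => ?_)
    (tendsto_const_div_atTop_nhds_zero_nat (hX.toFinset.card : ℝ))
  gcongr
  intro i hi
  simpa using (Finset.mem_filter.1 hi).2

lemma half_le_upperDensity {X : Set ℕ}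
    (hX : ∃ᶠ N : ℕ in atTop, N ≤ 2 * ((Finset.Icc 1 N).filter (fun i => i ∈ X)).card) :
    1 / 2 ≤ upperDensity X := by
  refine le_limsup_of_frequently_le ?_ ?_
  · refine (hX.and_eventually (eventually_gt_atTop 0)).mono ?_
    rintro N ⟨hN, hpos⟩
    have hpos' : (0 : ℝ) < N := by exact_mod_cast hpos
    have hN' : (N : ℝ) ≤ 2 * ((Finset.Icc 1 N).filter (fun i => i ∈ X)).card := by
      exact_mod_cast hN
    rw [le_div_iff₀ hpos']
    linarith
  · refine isBoundedUnder_of ⟨1, fun n => ?_⟩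
    refine div_le_one_of_le₀ ?_ (Nat.cast_nonneg n)
    exact_mod_cast (Finset.card_filter_le _ _).trans (by simp)

/-- Above every dyadic interval of level `p` there is a dyadic subinterval of level `p + q` on
which the digits `p + 1, …, p + q` agree with the indicator function of `A`. -/
lemma exists_dyadic_refinement (A : Set ℕ) (p : ℕ) (j : ℤ) (q : ℕ) :
    ∃ i : ℤ, ∀ ω : ℝ, ⌈(2 : ℝ) ^ (p + q) * ω⌉ = i →
      ⌈(2 : ℝ) ^ p * ω⌉ = j ∧ ∀ k < q, (p + 1 + k ∈ digitOneSet ω ↔ p + 1 + k ∈ A) := by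
  induction q with
  | zero => exact ⟨j, fun ω hω => ⟨hω, by simp⟩⟩
  | succ q ih =>
    obtain ⟨i, hi⟩ := ih
    refine ⟨2 * i - 1 + (if p + 1 + q ∈ A then 1 else 0), fun ω hω => ?_⟩
    have hprev : ⌈(2 : ℝ) ^ (p + q) * ω⌉ = i := by
      have hpow : (2 : ℝ) ^ (p + (q + 1)) * ω = 2 * ((2 : ℝ) ^ (p + q) * ω) := by ring
      rw [hpow, Int.ceil_eq_iff] at hω
      rw [Int.ceil_eq_iff]
      split_ifs at hω <;> push_cast at hω <;> constructor <;> linarith [hω.1, hω.2]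
    refine ⟨(hi ω hprev).1, fun k hk => ?_⟩
    rcases Nat.lt_succ_iff_lt_or_eq.1 hk with hk | rfl
    · exact (hi ω hprev).2 k hk
    · have hdigit : binDigit ω (p + 1 + k) = if p + 1 + k ∈ A then 1 else 0 := by
        have h₁ : p + 1 + k = p + (k + 1) := by omega
        have h₂ : p + 1 + k - 1 = p + k := by omega
        rw [binDigit, h₂, hprev, h₁, hω, h₁]
        ring
      have hone : 1 ≤ p + 1 + k := by omega
      simp [digitOneSet, hdigit, hone]

/-- Arbitrarily long initial segments of `T` have more than half of their elements in `A`. -/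
def FrequentlyDominates (A T : Set ℕ) : Prop :=
  ∀ n, ∃ M, n ≤ Nat.count (· ∈ T) M ∧
    Nat.count (· ∈ T) M + 2 ≤ 2 * Nat.count (fun k => k ∈ T ∧ k ∈ A) M

lemma count_of_agree_on_block {A T : Set ℕ} {p q n : ℕ}
    (hT : ∀ k < q, (p + 1 + k ∈ T ↔ p + 1 + k ∈ A))
    (hq : 2 * p + n + 4 ≤ Nat.count (· ∈ A) (p + 1 + q)) :
    n ≤ Nat.count (· ∈ T) (p + 1 + q) ∧
      Nat.count (· ∈ T) (p + 1 + q) + 2 ≤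
        2 * Nat.count (fun k => k ∈ T ∧ k ∈ A) (p + 1 + q) := by
  rw [Nat.count_add] at hq ⊢
  rw [Nat.count_add (fun k => k ∈ T ∧ k ∈ A)]
  have hTA : Nat.count (fun k => p + 1 + k ∈ T) q = Nat.count (fun k => p + 1 + k ∈ A) q := by
    simp only [Nat.count_eq_card_filter_range]
    congr 1
    exact Finset.filter_congr fun k hk => hT k (Finset.mem_range.1 hk)
  have hTA' : Nat.count (fun k => p + 1 + k ∈ T ∧ p + 1 + k ∈ A) q =
      Nat.count (fun k => p + 1 + k ∈ A) q := by
    simp only [Nat.count_eq_card_filter_range]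
    congr 1
    refine Finset.filter_congr fun k hk => ?_
    simp [hT k (Finset.mem_range.1 hk)]
  have h₁ := Nat.count_le (p := (· ∈ T)) (n := p + 1)
  have h₂ := Nat.count_le (p := (· ∈ A)) (n := p + 1)
  omega

lemma eventually_residual_frequentlyDominates {A : Set ℕ} (hA : A.Infinite) :
    ∀ᶠ ω : Set.Ioc (0 : ℝ) 1 in residual (Set.Ioc (0 : ℝ) 1),
      FrequentlyDominates A (digitOneSet ω.1) := by
  refine eventually_countable_forall.2 fun n => ?_
  set S : Set (Set.Ioc (0 : ℝ) 1) := {ω | ∃ M, n ≤ Nat.count (· ∈ digitOneSet ω.1) M ∧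
    Nat.count (· ∈ digitOneSet ω.1) M + 2 ≤
      2 * Nat.count (fun k => k ∈ digitOneSet ω.1 ∧ k ∈ A) M}
  suffices hdense : Dense (interior S) from
    mem_of_superset (residual_of_dense_open isOpen_interior hdense) interior_subset
  rw [Metric.dense_iff]
  intro ω₀ δ hδ
  obtain ⟨p, hp⟩ := exists_pow_lt_of_lt_one hδ (by norm_num : (1 / 2 : ℝ) < 1)
  set q := Nat.nth (· ∈ A) (2 * p + n + 4)
  have hcount : 2 * p + n + 4 ≤ Nat.count (· ∈ A) (p + 1 + q) := by
    calc 2 * p + n + 4 = Nat.count (· ∈ A) q :=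
          (Nat.count_nth_of_infinite (p := (· ∈ A)) hA _).symm
      _ ≤ _ := Nat.count_monotone _ (by omega)
  obtain ⟨i, hi⟩ := exists_dyadic_refinement A p ⌈(2 : ℝ) ^ p * ω₀⌉ q
  have hpow : (0 : ℝ) < 2 ^ (p + q) := by positivity
  have hpowp : (0 : ℝ) < 2 ^ p := by positivity
  set ω₁ : ℝ := (i - 1 / 2) / 2 ^ (p + q) with hω₁
  have hmul : (2 : ℝ) ^ (p + q) * ω₁ = i - 1 / 2 := by rw [hω₁]; field_simp
  have hceil : ⌈(2 : ℝ) ^ (p + q) * ω₁⌉ = i := by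
    rw [hmul, Int.ceil_eq_iff]; constructor <;> linarith
  have hcoarse := (hi ω₁ hceil).1
  have hlow := Int.ceil_lt_add_one ((2 : ℝ) ^ p * ω₀)
  have hup := Int.le_ceil ((2 : ℝ) ^ p * ω₀)
  rw [Int.ceil_eq_iff] at hcoarse
  have hpos : 0 < ω₁ := by
    have : (1 : ℤ) ≤ ⌈(2 : ℝ) ^ p * ω₀⌉ := Int.one_le_ceil_iff.2 (mul_pos hpowp ω₀.2.1)
    have : (1 : ℝ) ≤ ⌈(2 : ℝ) ^ p * ω₀⌉ := by exact_mod_cast this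
    exact pos_of_mul_pos_right (by linarith [hcoarse.1]) hpowp.le
  have hle : ω₁ ≤ 1 := by
    have : ⌈(2 : ℝ) ^ p * ω₀⌉ ≤ (2 ^ p : ℤ) := by
      rw [Int.ceil_le]
      push_cast
      exact mul_le_of_le_one_right hpowp.le ω₀.2.2
    have : (⌈(2 : ℝ) ^ p * ω₀⌉ : ℝ) ≤ 2 ^ p := by exact_mod_cast this
    exact le_of_mul_le_mul_left (by linarith [hcoarse.2]) hpowp
  refine ⟨⟨ω₁, hpos, hle⟩, ?_, ?_⟩
  · rw [Metric.mem_ball, Subtype.dist_eq, Real.dist_eq]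
    refine lt_of_lt_of_le ?_ hp.le
    have hone : (2 : ℝ) ^ p * (1 / 2) ^ p = 1 := by rw [← mul_pow]; norm_num
    rw [abs_sub_lt_iff]
    constructor <;> refine lt_of_mul_lt_mul_left ?_ hpowp.le <;>
      rw [mul_sub, hone] <;> linarith [hcoarse.1, hcoarse.2]
  · rw [mem_interior]
    refine ⟨{ω | (2 : ℝ) ^ (p + q) * ω.1 ∈ Set.Ioo ((i : ℝ) - 1) i}, fun ω hω => ?_, ?_, ?_⟩
    · exact ⟨p + 1 + q, count_of_agree_on_block
        (hi ω (Int.ceil_eq_iff.2 ⟨hω.1, hω.2.le⟩)).2 hcount⟩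
    · exact isOpen_Ioo.preimage (by fun_prop)
    · change (2 : ℝ) ^ (p + q) * ω₁ ∈ Set.Ioo ((i : ℝ) - 1) i
      rw [hmul]
      constructor <;> linarith

lemma FrequentlyDominates.infinite {A T : Set ℕ} (h : FrequentlyDominates A T) : T.Infinite := by
  intro hT
  obtain ⟨M, hM, -⟩ := h (hT.toFinset.card + 1)
  rw [Nat.count_eq_card_filter_range] at hM
  have : ((Finset.range M).filter (· ∈ T)).card ≤ hT.toFinset.card :=
    Finset.card_le_card fun i hi => by simpa using (Finset.mem_filter.1 hi).2
  omega

lemma FrequentlyDominates.half_le_upperDensity {A T : Set ℕ} (h : FrequentlyDominates A T) :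
    1 / 2 ≤ upperDensity {k | Nat.nth (· ∈ T) k ∈ A} := by
  refine _root_.half_le_upperDensity (frequently_atTop.2 fun n => ?_)
  obtain ⟨M, hn, hM⟩ := h n
  refine ⟨_, hn, ?_⟩
  have hcard : Nat.count (fun k => k ∈ T ∧ k ∈ A) M ≤
      ((Finset.Icc 1 (Nat.count (· ∈ T) M)).filter
        (fun k => k ∈ {k | Nat.nth (· ∈ T) k ∈ A})).card + 1 := by
    rw [Nat.count_eq_card_filter_range]
    refine le_trans ?_ (Finset.card_insert_le 0 _)
    refine Finset.card_le_card_of_injOn (Nat.count (· ∈ T)) ?_ ?_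
    · intro k hk
      simp only [Finset.coe_filter, Finset.mem_range, Set.mem_ofPred_eq] at hk
      have hmem : Nat.nth (· ∈ T) (Nat.count (· ∈ T) k) ∈ A := by
        rw [Nat.nth_count hk.2.1]; exact hk.2.2
      have hle := Nat.count_monotone (· ∈ T) hk.1.le
      simp only [Finset.coe_insert, Finset.coe_filter, Set.mem_insert_iff, Finset.mem_Icc,
        Set.mem_ofPred_eq]
      by_cases hzero : Nat.count (· ∈ T) k = 0
      · exact Or.inl hzero
      · exact Or.inr ⟨⟨Nat.one_le_iff_ne_zero.2 hzero, hle⟩, hmem⟩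
    · intro a ha b hb hab
      simp only [Finset.coe_filter, Set.mem_ofPred_eq] at ha hb
      exact Nat.count_injective ha.2.1 hb.2.1 hab
  omega

lemma upperDensity_mono {X Y : Set ℕ} (h : X ⊆ Y) : upperDensity X ≤ upperDensity Y := by
  refine limsup_le_limsup (Eventually.of_forall fun n => ?_) ?_ ?_
  · dsimp only
    gcongr
  · exact isCoboundedUnder_le_of_le _ (x := 0) fun n => by positivity
  · refine isBoundedUnder_of ⟨1, fun n => ?_⟩
    refine div_le_one_of_le₀ ?_ (Nat.cast_nonneg n)
    exact_mod_cast (Finset.card_filter_le _ _).trans (by simp)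

lemma IsStatClusterPt.isLimitPt {x : ℕ → ℝ} {ℓ : ℝ} (h : IsStatClusterPt x ℓ) :
    IsLimitPt x ℓ := by
  rw [isLimitPt_iff_frequently]
  intro ε hε
  rw [Nat.frequently_atTop_iff_infinite]
  intro hfin
  exact (h ε hε).ne' (upperDensity_eq_zero_of_finite hfin)

lemma IsLimitPt.of_subseq {x : ℕ → ℝ} {ℓ : ℝ} {φ : ℕ → ℕ} (hφ : StrictMono φ)
    (h : IsLimitPt (fun k => x (φ k)) ℓ) : IsLimitPt x ℓ := by
  obtain ⟨ψ, hψ, hlim⟩ := h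
  exact ⟨φ ∘ ψ, hφ.comp hψ, hlim⟩

/-- If `Γ_x = L_x`, then `{ω ∈ (0,1] : Γ_x = Γ_{x↾ω}}` is comeager in `(0,1]`. -/
theorem stmt1 (x : ℕ → ℝ) (h : statClusterPts x = limitPts x) :
    {ω : Set.Ioc (0 : ℝ) 1 | statClusterPts x = statClusterPts (subseq x ω.1)} ∈
      residual (Set.Ioc (0 : ℝ) 1) := by
  have hballs : ∀ᶠ ω : Set.Ioc (0 : ℝ) 1 in residual (Set.Ioc (0 : ℝ) 1), ∀ c : ℚ × ℚ,
      {n | |x n - c.1| < c.2}.Infinite →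
        FrequentlyDominates {n | |x n - c.1| < c.2} (digitOneSet ω.1) := by
    refine eventually_countable_forall.2 fun c => ?_
    by_cases hc : {n | |x n - c.1| < c.2}.Infinite
    · filter_upwards [eventually_residual_frequentlyDominates hc] with ω hω _ using hω
    · exact Eventually.of_forall fun ω hω => absurd hω hc
  filter_upwards [hballs, eventually_residual_frequentlyDominates Set.infinite_univ]
    with ω hω huniv
  rw [h]
  ext ℓ
  constructor
  · intro hℓ ε hε
    obtain ⟨r, hr, hrε⟩ := exists_rat_btwn (half_pos hε)
    obtain ⟨c, hc, hcr⟩ := exists_rat_btwn (show ℓ < ℓ + r / 2 by linarith)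
    have hinf : {n | |x n - c| < r}.Infinite := by
      rw [← Nat.frequently_atTop_iff_infinite]
      refine ((isLimitPt_iff_frequently x ℓ).1 hℓ (r / 3) (by linarith)).mono fun n hn => ?_
      rw [abs_le] at hn
      rw [abs_lt]
      constructor <;> linarith [hn.1, hn.2]
    have hhalf := (hω (c, r) hinf).half_le_upperDensity
    refine lt_of_lt_of_le (by norm_num) (hhalf.trans (upperDensity_mono fun k hk => ?_))
    simp only [Set.mem_ofPred_eq, abs_lt] at hk
    simp only [Set.mem_ofPred_eq, subseq, abs_le]
    constructor <;> linarith [hk.1, hk.2]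
  · intro hℓ
    exact (IsStatClusterPt.isLimitPt hℓ).of_subseq (Nat.nth_strictMono huniv.infinite)
end

section
/- Let x = (x_n) be a real sequence. Then the set {ω ∈ (0,1] : Λ_x = Λ_{x↾ω}} is not meager in (0,1] if and only if every ordinary limit point of x is also a statistical limit point of x, i.e., Λ_x = L_x. -/
open Filter Set Topology
open scoped Classical

theorem le_upperDensity_of_frequently {A : Set ℕ} {c : ℝ}
    (h : ∃ᶠ n : ℕ in atTop, c ≤ (((Finset.Icc 1 n).filter (fun i => i ∈ A)).card : ℝ) / n) :
    c ≤ upperDensity A := by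
  refine le_limsup_of_frequently_le h (isBoundedUnder_of ⟨1, fun n => ?_⟩)
  refine div_le_one_of_le₀ ?_ n.cast_nonneg
  have : ((Finset.Icc 1 n).filter (fun i => i ∈ A)).card ≤ (Finset.Icc 1 n).card :=
    Finset.card_filter_le _ _
  rw [Nat.card_Icc, Nat.add_sub_cancel] at this
  exact_mod_cast this

/-- If, for every `ε > 0`, the terms of `y` outside the `ε`-neighbourhood of `ℓ` have lower
density zero, then `ℓ` is a statistical limit point of `y`. -/
theorem isStatLimitPt_of_sparse_exceptions {y : ℕ → ℝ} {ℓ : ℝ}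
    (h : ∀ ε : ℝ, 0 < ε → ∀ k : ℕ, ∃ N, k ≤ N ∧
      (k + 1) * ((Finset.range N).filter (fun i => ε < |y i - ℓ|)).card ≤ N) :
    IsStatLimitPt y ℓ := by
  have hfreq : ∀ j : ℕ, ∃ᶠ N in atTop, 4 * ((Finset.range N).filter
      (fun i => 1 / ((j : ℝ) + 1) < |y i - ℓ|)).card ≤ N := by
    intro j
    rw [frequently_atTop]
    intro a
    obtain ⟨N, hN, hc⟩ := h (1 / ((j : ℝ) + 1)) (by positivity) (a + 3)
    exact ⟨N, by lia, le_trans (Nat.mul_le_mul_right _ (by lia)) hc⟩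
  obtain ⟨φ, hφ, hc⟩ := extraction_forall_of_frequently hfreq
  set A : Set ℕ := {i | ∀ j, φ j ≤ i → |y i - ℓ| ≤ 1 / ((j : ℝ) + 1)}
  have hcard : ∀ j, 3 * φ j ≤ 4 * ((Finset.Icc 1 (φ j)).filter (fun i => i ∈ A)).card + 4 := by
    intro j
    have hsub : Finset.range (φ j) ⊆ insert 0 ((Finset.Icc 1 (φ j)).filter (fun i => i ∈ A)) ∪
        (Finset.range (φ j)).filter (fun i => 1 / ((j : ℝ) + 1) < |y i - ℓ|) := by
      intro i hi
      simp only [Finset.mem_union, Finset.mem_insert, Finset.mem_filter, Finset.mem_Icc]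
      by_cases hb : 1 / ((j : ℝ) + 1) < |y i - ℓ|
      · exact Or.inr ⟨hi, hb⟩
      rcases Nat.eq_zero_or_pos i with h0 | h0
      · exact Or.inl (Or.inl h0)
      rw [Finset.mem_range] at hi
      refine Or.inl (Or.inr ⟨⟨h0, hi.le⟩, fun j' hj' => (not_lt.mp hb).trans ?_⟩)
      have : j' < j := hφ.lt_iff_lt.mp (hj'.trans_lt hi)
      gcongr
    have h1 := (Finset.card_le_card hsub).trans (Finset.card_union_le _ _)
    have h2 := Finset.card_insert_le 0 ((Finset.Icc 1 (φ j)).filter (fun i => i ∈ A))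
    have h3 := hc j
    rw [Finset.card_range] at h1
    lia
  have hdens : 1 / 4 ≤ upperDensity A := by
    refine le_upperDensity_of_frequently (frequently_atTop.mpr fun a => ⟨φ (a + 2), ?_, ?_⟩)
    · exact (Nat.le_add_right a 2).trans (hφ.id_le (a + 2))
    · have h1 := hcard (a + 2)
      have h2 : a + 2 ≤ φ (a + 2) := hφ.id_le (a + 2)
      have h3 : φ (a + 2) ≤
          4 * ((Finset.Icc 1 (φ (a + 2))).filter (fun i => i ∈ A)).card := by lia
      have h4 : (0 : ℝ) < φ (a + 2) := by exact_mod_cast (by lia : 0 < φ (a + 2))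
      rw [le_div_iff₀ h4]
      have h5 : (φ (a + 2) : ℝ) ≤
          4 * ((Finset.Icc 1 (φ (a + 2))).filter (fun i => i ∈ A)).card := by exact_mod_cast h3
      linarith
  have hinf : A.Infinite := by
    intro hfin
    have h1 := hcard (2 * hfin.toFinset.card + 2)
    have h2 : 2 * hfin.toFinset.card + 2 ≤ φ (2 * hfin.toFinset.card + 2) := hφ.id_le _
    have h3 : ((Finset.Icc 1 (φ (2 * hfin.toFinset.card + 2))).filter (fun i => i ∈ A)).card ≤
        hfin.toFinset.card := Finset.card_le_card fun i hi => by
      rw [Set.Finite.mem_toFinset]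
      exact (Finset.mem_filter.mp hi).2
    lia
  have hmono : StrictMono (Nat.nth (fun i => i ∈ A)) := Nat.nth_strictMono hinf
  refine ⟨Nat.nth (fun i => i ∈ A), hmono, ?_, ?_⟩
  · rw [Metric.tendsto_atTop]
    intro ε hε
    obtain ⟨j, hj⟩ := exists_nat_one_div_lt hε
    refine ⟨φ j, fun n hn => ?_⟩
    have hmem : Nat.nth (fun i => i ∈ A) n ∈ A := Nat.nth_mem_of_infinite hinf n
    rw [Real.dist_eq]
    exact (hmem j (hn.trans (hmono.id_le n))).trans_lt hj
  · have : Set.range (Nat.nth (fun i => i ∈ A)) = A := Nat.range_nth_of_infinite hinf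
    rw [this]
    linarith

theorem IsLimitPt.infinite_setOf {x : ℕ → ℝ} {ℓ : ℝ} (h : IsLimitPt x ℓ) {r ε : ℝ}
    (hr : |ℓ - r| < ε) : {n | |x n - r| ≤ ε}.Infinite := by
  obtain ⟨φ, hφ, hlim⟩ := h
  have hev : ∀ᶠ k in atTop, |x (φ k) - r| < ε :=
    ((hlim.sub_const r).abs).eventually_lt_const hr
  obtain ⟨K, hK⟩ := eventually_atTop.mp hev
  have hinj : Function.Injective fun k => φ (k + K) := fun a b hab => by
    have := hφ.injective hab
    lia
  exact Set.infinite_of_injective_forall_mem hinj fun k => (hK (k + K) (by lia)).le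

/-- The open dyadic interval `(b / 2 ^ q, (b + 1) / 2 ^ q)`. -/
def dyadicIoo (q b : ℕ) : Set ℝ := {ω | (b : ℝ) < 2 ^ q * ω ∧ 2 ^ q * ω < b + 1}

/-- Inside every dyadic interval of level `q`, one of level `q + d + 1` prescribes the next digits
to be `d` zeros followed by a one. -/
theorem dyadicIoo_zeros_then_one {q b d : ℕ} {ω : ℝ}
    (hω : ω ∈ dyadicIoo (q + d + 1) (b * 2 ^ (d + 1) + 1)) :
    ω ∈ dyadicIoo q b ∧ (∀ i < d, q + i + 1 ∉ digitOneSet ω) ∧ q + d + 1 ∈ digitOneSet ω := by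
  obtain ⟨h1, h2⟩ := hω
  push_cast at h1 h2
  have hmem : ∀ i ≤ d, ω ∈ dyadicIoo (q + i) (b * 2 ^ i) := by
    intro i hi
    obtain ⟨e, rfl⟩ := Nat.exists_eq_add_of_le hi
    have hp : (1 : ℝ) ≤ 2 ^ e := one_le_pow₀ (by norm_num)
    have e1 : (2 : ℝ) ^ (q + (i + e) + 1) * ω = (2 * 2 ^ e) * (2 ^ (q + i) * ω) := by ring
    have e2 : (b : ℝ) * 2 ^ (i + e + 1) = (2 * 2 ^ e) * (b * 2 ^ i) := by ring
    rw [e1, e2] at h1 h2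
    constructor
    · push_cast
      by_contra! hcon
      nlinarith
    · push_cast
      by_contra! hcon
      nlinarith
  have hceil : ∀ i ≤ d, ⌈(2 : ℝ) ^ (q + i) * ω⌉ = b * 2 ^ i + 1 := by
    intro i hi
    obtain ⟨ha, hb⟩ := hmem i hi
    rw [Int.ceil_eq_iff]
    push_cast at ha hb ⊢
    exact ⟨by linarith, hb.le⟩
  have hlast : ⌈(2 : ℝ) ^ (q + d + 1) * ω⌉ = b * 2 ^ (d + 1) + 2 := by
    rw [Int.ceil_eq_iff]
    push_cast
    exact ⟨by linarith, by linarith⟩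
  refine ⟨by simpa using hmem 0 d.zero_le, fun i hi hdig => ?_, by lia, ?_⟩
  · have := hdig.2
    rw [binDigit, Nat.add_sub_cancel, add_assoc, hceil (i + 1) hi, hceil i hi.le] at this
    ring_nf at this
    lia
  · rw [binDigit, Nat.add_sub_cancel, hlast, hceil d le_rfl]
    ring

/-- Inside every dyadic interval of level `q` there is one on which the next `M` digits equal to
one occur at positions in `H`. -/
theorem exists_dyadicIoo_ones_mem {H : Set ℕ} (hH : H.Infinite) {q b : ℕ} (hb : b + 1 ≤ 2 ^ q)
    (M : ℕ) : ∃ q' b' : ℕ, b' + 1 ≤ 2 ^ q' ∧ ∀ ω ∈ dyadicIoo q' b', ω ∈ dyadicIoo q b ∧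
      M ≤ Nat.count (fun n => n ∈ digitOneSet ω) (q' + 1) ∧
      ((Finset.range (Nat.count (fun n => n ∈ digitOneSet ω) (q' + 1))).filter
        (fun i => Nat.nth (fun n => n ∈ digitOneSet ω) i ∉ H)).card ≤ q + 1 := by
  induction M with
  | zero =>
    refine ⟨q, b, hb, fun ω hω => ⟨hω, Nat.zero_le _, ?_⟩⟩
    refine (Finset.card_filter_le _ _).trans ?_
    rw [Finset.card_range]
    exact Nat.count_le _
  | succ M ih =>
    obtain ⟨q', b', hb', hprop⟩ := ih
    obtain ⟨n, hnH, hn⟩ := hH.exists_gt q'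
    obtain ⟨d, rfl⟩ := Nat.exists_eq_add_of_lt hn
    refine ⟨q' + d + 1, b' * 2 ^ (d + 1) + 1, ?_, fun ω hω => ?_⟩
    · have h1 : 2 ≤ 2 ^ (d + 1) := by
        rw [pow_succ]
        have := Nat.one_le_two_pow (n := d)
        lia
      calc b' * 2 ^ (d + 1) + 1 + 1 ≤ (b' + 1) * 2 ^ (d + 1) := by lia
        _ ≤ 2 ^ q' * 2 ^ (d + 1) := Nat.mul_le_mul_right _ hb'
        _ = 2 ^ (q' + d + 1) := by ring
    · obtain ⟨hω', hzero, hone⟩ := dyadicIoo_zeros_then_one hω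
      obtain ⟨hωq, hM, hbad⟩ := hprop ω hω'
      have hcount : ∀ i ≤ d, Nat.count (fun n => n ∈ digitOneSet ω) (q' + i + 1) =
          Nat.count (fun n => n ∈ digitOneSet ω) (q' + 1) := by
        intro i
        induction i with
        | zero => simp
        | succ i ihi =>
          intro hi
          rw [← add_assoc, Nat.count_succ, if_neg (hzero i hi), ihi (by lia), add_zero]
      have hnth := Nat.nth_count (p := fun n => n ∈ digitOneSet ω) hone
      rw [hcount d le_rfl] at hnth
      have hsucc : Nat.count (fun n => n ∈ digitOneSet ω) (q' + d + 1 + 1) =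
          Nat.count (fun n => n ∈ digitOneSet ω) (q' + 1) + 1 := by
        rw [Nat.count_succ, if_pos hone, hcount d le_rfl]
      rw [hsucc]
      refine ⟨hωq, by lia, ?_⟩
      rw [Finset.range_add_one, Finset.filter_insert, hnth, if_neg (not_not.mpr hnH)]
      exact hbad

theorem exists_dyadicIoo_subset {U : Set (Set.Ioc (0 : ℝ) 1)} (hU : IsOpen U) (hne : U.Nonempty) :
    ∃ q b : ℕ, b + 1 ≤ 2 ^ q ∧ ∀ ω : Set.Ioc (0 : ℝ) 1, ω.1 ∈ dyadicIoo q b → ω ∈ U := by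
  obtain ⟨ω₀, hω₀⟩ := hne
  obtain ⟨δ, hδ, hball⟩ := Metric.isOpen_iff.mp hU ω₀ hω₀
  obtain ⟨q, hq⟩ := exists_pow_lt_of_lt_one hδ (by norm_num : (1 / 2 : ℝ) < 1)
  have hp : (0 : ℝ) < 2 ^ q := by positivity
  have hpos : 0 < ⌈(2 : ℝ) ^ q * ω₀.1⌉₊ := Nat.ceil_pos.mpr (mul_pos hp ω₀.2.1)
  obtain ⟨b, hb⟩ := Nat.exists_eq_succ_of_ne_zero hpos.ne'
  have h1 := (Nat.ceil_eq_iff (Nat.succ_ne_zero b)).mp hb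
  simp only [Nat.succ_sub_one, Nat.cast_succ] at h1
  refine ⟨q, b, ?_, fun ω hω => hball ?_⟩
  · rw [← Nat.succ_eq_add_one, ← hb, Nat.ceil_le]
    push_cast
    nlinarith [ω₀.2.2]
  · rw [Metric.mem_ball, Subtype.dist_eq, Real.dist_eq]
    refine lt_of_le_of_lt ?_ hq
    have hinv : (2 : ℝ) ^ q * (1 / 2) ^ q = 1 := by rw [← mul_pow]; norm_num
    obtain ⟨h2, h3⟩ := hω
    rw [abs_le]
    constructor <;> refine le_of_mul_le_mul_left ?_ hp <;> linarith

theorem isOpen_dyadicIoo (q b : ℕ) : IsOpen (dyadicIoo q b) :=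
  (isOpen_lt continuous_const (continuous_const.mul continuous_id)).inter
    (isOpen_lt (continuous_const.mul continuous_id) continuous_const)

theorem exists_mem_dyadicIoo {q b : ℕ} (hb : b + 1 ≤ 2 ^ q) :
    ∃ ω : Set.Ioc (0 : ℝ) 1, ω.1 ∈ dyadicIoo q b := by
  have hp : (0 : ℝ) < 2 ^ q := by positivity
  have hb' : (b : ℝ) + 1 ≤ 2 ^ q := by exact_mod_cast hb
  have hmul : (2 : ℝ) ^ q * ((b + 1 / 2) / 2 ^ q) = b + 1 / 2 := by field_simp
  refine ⟨⟨(b + 1 / 2) / 2 ^ q, by positivity, ?_⟩, ?_, ?_⟩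
  · rw [div_le_one hp]
    linarith
  · rw [hmul]
    linarith
  · rw [hmul]
    linarith

/-- For a comeagre set of `ω`, the proportion of the positions of the ones of `ω` lying in a given
infinite set gets arbitrarily close to one. -/
theorem eventually_residual_sparse_compl {H : Set ℕ} (hH : H.Infinite) (k : ℕ) :
    ∀ᶠ ω : Set.Ioc (0 : ℝ) 1 in residual (Set.Ioc (0 : ℝ) 1), ∃ n,
      k ≤ Nat.count (fun n => n ∈ digitOneSet ω.1) n ∧
      (k + 1) * ((Finset.range (Nat.count (fun n => n ∈ digitOneSet ω.1) n)).filter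
        (fun i => Nat.nth (fun n => n ∈ digitOneSet ω.1) i ∉ H)).card ≤
          Nat.count (fun n => n ∈ digitOneSet ω.1) n := by
  refine mem_of_superset (residual_of_dense_open isOpen_interior ?_) interior_subset
  rw [dense_iff_inter_open]
  intro U hU hne
  obtain ⟨q, b, hb, hsub⟩ := exists_dyadicIoo_subset hU hne
  obtain ⟨q', b', hb', hprop⟩ := exists_dyadicIoo_ones_mem hH hb ((k + 1) * (q + 1) + k)
  obtain ⟨ω, hω⟩ := exists_mem_dyadicIoo hb'
  refine ⟨ω, hsub ω (hprop ω hω).1, mem_interior.mpr ⟨Subtype.val ⁻¹' dyadicIoo q' b', ?_,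
    (isOpen_dyadicIoo q' b').preimage continuous_subtype_val, hω⟩⟩
  intro ω' hω'
  obtain ⟨-, h1, h2⟩ := hprop ω' hω'
  exact ⟨q' + 1, by lia, (Nat.mul_le_mul_left (k + 1) h2).trans (by lia)⟩

/-- For a comeagre set of `ω`, the statistical limit points of `x↾ω` are exactly the ordinary
limit points of `x`. -/
theorem eventually_residual_statLimitPts_subseq (x : ℕ → ℝ) :
    ∀ᶠ ω : Set.Ioc (0 : ℝ) 1 in residual (Set.Ioc (0 : ℝ) 1),
      statLimitPts (subseq x ω.1) = limitPts x := by
  have hones := eventually_countable_forall.mpr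
    (eventually_residual_sparse_compl Set.infinite_univ)
  have hnear := eventually_countable_forall.mpr fun r : ℚ => eventually_countable_forall.mpr
    fun m : ℕ => eventually_countable_forall.mpr
      fun hH : {n | |x n - r| ≤ 1 / ((m : ℝ) + 1)}.Infinite =>
        eventually_countable_forall.mpr (eventually_residual_sparse_compl hH)
  filter_upwards [hones, hnear] with ω h1 h2
  have hinf : (digitOneSet ω.1).Infinite := by
    intro hfin
    obtain ⟨n, hn, -⟩ := h1 (hfin.toFinset.card + 1)
    have : Nat.count (fun n => n ∈ digitOneSet ω.1) n ≤ hfin.toFinset.card :=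
      Nat.count_le_card (p := fun n => n ∈ digitOneSet ω.1) hfin n
    lia
  ext ℓ
  constructor
  · rintro ⟨φ, hφ, hlim, -⟩
    exact ⟨_, (Nat.nth_strictMono hinf).comp hφ, hlim⟩
  · intro hℓ
    refine isStatLimitPt_of_sparse_exceptions fun ε hε k => ?_
    obtain ⟨m, hm⟩ := exists_nat_one_div_lt (half_pos hε)
    obtain ⟨r, hr⟩ := exists_rat_near ℓ (Nat.one_div_pos_of_nat (n := m) : (0 : ℝ) < _)
    obtain ⟨n, hk, hn⟩ := h2 r m (IsLimitPt.infinite_setOf hℓ hr) k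
    refine ⟨_, hk, le_trans (Nat.mul_le_mul_left _ (Finset.card_le_card ?_)) hn⟩
    refine Finset.monotone_filter_right _ fun i _ hi hmem => ?_
    have h3 : |subseq x ω.1 i - r| ≤ 1 / ((m : ℝ) + 1) := hmem
    have h4 := abs_sub_le (subseq x ω.1 i) r ℓ
    rw [abs_sub_comm (r : ℝ) ℓ] at h4
    linarith

/-- Theorem 3: `{ω ∈ (0,1] : Λ_x = Λ_{x↾ω}}` is non-meager in `(0,1]`
iff every ordinary limit point of `x` is a statistical limit point, i.e. `Λ_x = L_x`. -/
theorem stmt3 (x : ℕ → ℝ) :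
    ¬ IsMeagre {ω : Set.Ioc (0 : ℝ) 1 | statLimitPts x = statLimitPts (subseq x ω.1)} ↔
      statLimitPts x = limitPts x := by
  have hgen := eventually_residual_statLimitPts_subseq x
  constructor
  · intro h
    by_contra hne
    refine h (mem_of_superset hgen fun ω hω hmem => hne ?_)
    exact (show statLimitPts x = statLimitPts (subseq x ω.1) from hmem).trans hω
  · intro heq hmeagre
    have : LocallyCompactSpace (Set.Ioc (0 : ℝ) 1) := isLocallyClosed_Ioc.locallyCompactSpace
    have : Nonempty (Set.Ioc (0 : ℝ) 1) := ⟨⟨1, by norm_num, le_rfl⟩⟩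
    obtain ⟨ω, hω, hmem⟩ := (dense_of_mem_residual (inter_mem hgen hmeagre)).nonempty
    exact hmem (heq.trans hω.symm)
end

section
/- Let x = (x_n) be a real sequence and let ℓ be an ordinary limit point of x. Then for every nonempty interval I ⊆ (0,1] and every m ∈ ℕ with m ≥ 1, there exists ω₀ ∈ I such that q_{ω₀,m}(N) ≥ 1/2 for all sufficiently large N ∈ ℕ. -/
open Filter Set Topology
open scoped Classical

/-- The number in `(0, 1]` whose `i`-th binary digit is the indicator of `j + i ∈ A`. -/
noncomputable def binaryTail (A : Set ℕ) (j : ℕ) : ℝ :=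
  ∑' i : ℕ, A.indicator (fun _ => (1 : ℝ)) (j + 1 + i) / 2 / 2 ^ i

lemma indicator_one_div_le (A : Set ℕ) (k i : ℕ) :
    A.indicator (fun _ => (1 : ℝ)) k / 2 / 2 ^ i ≤ 1 / 2 / 2 ^ i := by
  gcongr
  exact indicator_le_self' (fun _ _ => zero_le_one) k

lemma indicator_one_div_nonneg (A : Set ℕ) (k i : ℕ) :
    0 ≤ A.indicator (fun _ => (1 : ℝ)) k / 2 / 2 ^ i := by
  have : 0 ≤ A.indicator (fun _ => (1 : ℝ)) k := indicator_nonneg (fun _ _ => zero_le_one) k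
  positivity

lemma summable_binaryTail (A : Set ℕ) (j : ℕ) :
    Summable (fun i : ℕ => A.indicator (fun _ => (1 : ℝ)) (j + 1 + i) / 2 / 2 ^ i) :=
  (summable_geometric_two' (1 : ℝ)).of_nonneg_of_le
    (fun i => indicator_one_div_nonneg A _ i) (fun i => indicator_one_div_le A _ i)

lemma binaryTail_le_one (A : Set ℕ) (j : ℕ) : binaryTail A j ≤ 1 :=
  ((summable_binaryTail A j).tsum_le_tsum (fun i => indicator_one_div_le A _ i)
    (summable_geometric_two' (1 : ℝ))).trans_eq (tsum_geometric_two' 1)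

lemma binaryTail_pos {A : Set ℕ} (hA : A.Infinite) (j : ℕ) : 0 < binaryTail A j := by
  obtain ⟨k, hk, hjk⟩ := hA.exists_gt j
  obtain ⟨i, rfl⟩ := Nat.exists_eq_add_of_le (Nat.succ_le_of_lt hjk)
  refine (summable_binaryTail A j).tsum_pos (fun i => indicator_one_div_nonneg A _ i) i ?_
  rw [indicator_of_mem hk]
  positivity

lemma two_mul_binaryTail (A : Set ℕ) (j : ℕ) :
    2 * binaryTail A j = A.indicator (fun _ => (1 : ℝ)) (j + 1) + binaryTail A (j + 1) := by
  have h : ∀ i : ℕ, A.indicator (fun _ => (1 : ℝ)) (j + 1 + (i + 1)) / 2 / 2 ^ (i + 1) =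
      1 / 2 * (A.indicator (fun _ => (1 : ℝ)) (j + 1 + 1 + i) / 2 / 2 ^ i) := by
    intro i
    rw [show j + 1 + (i + 1) = j + 1 + 1 + i by omega, pow_succ]
    field_simp
  rw [binaryTail, (summable_binaryTail A j).tsum_eq_zero_add, tsum_congr h, tsum_mul_left,
    ← binaryTail]
  simp only [add_zero, pow_zero]
  ring

lemma exists_int_two_pow_mul_eq_add_binaryTail {A : Set ℕ} {ω : ℝ} {n : ℕ} {c : ℤ}
    (hω : 2 ^ n * ω = c + binaryTail A n) {k : ℕ} (hk : n ≤ k) :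
    ∃ M : ℤ, 2 ^ k * ω = M + binaryTail A k := by
  induction k, hk using Nat.le_induction with
  | base => exact ⟨c, hω⟩
  | succ k _ ih =>
    obtain ⟨M, hM⟩ := ih
    refine ⟨2 * M + A.indicator (fun _ => (1 : ℤ)) (k + 1), ?_⟩
    have h := two_mul_binaryTail A k
    rw [pow_succ, mul_right_comm, hM]
    by_cases hA : k + 1 ∈ A <;> simp [hA] at h ⊢ <;> linarith

lemma ceil_int_add_binaryTail {A : Set ℕ} (hA : A.Infinite) (M : ℤ) (k : ℕ) :
    ⌈(M : ℝ) + binaryTail A k⌉ = M + 1 := by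
  rw [Int.ceil_eq_iff]
  have := binaryTail_pos hA k
  have := binaryTail_le_one A k
  push_cast
  constructor <;> linarith

lemma mem_digitOneSet_iff_of_gt {A : Set ℕ} (hA : A.Infinite) {ω : ℝ} {n : ℕ} {c : ℤ}
    (hω : 2 ^ n * ω = c + binaryTail A n) {k : ℕ} (hk : n < k) :
    k ∈ digitOneSet ω ↔ k ∈ A := by
  obtain ⟨k, rfl⟩ := Nat.exists_eq_succ_of_ne_zero (Nat.ne_zero_of_lt hk)
  obtain ⟨M, hM⟩ := exists_int_two_pow_mul_eq_add_binaryTail hω (Nat.le_of_lt_succ hk)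
  have h := two_mul_binaryTail A k
  have hM' : 2 ^ (k + 1) * ω =
      ((2 * M + A.indicator (fun _ => (1 : ℤ)) (k + 1) : ℤ) : ℝ) + binaryTail A (k + 1) := by
    rw [pow_succ, mul_right_comm, hM]
    by_cases hA : k + 1 ∈ A <;> simp [hA] at h ⊢ <;> linarith
  simp only [digitOneSet, binDigit, mem_ofPred_eq, Nat.succ_eq_add_one, Nat.add_sub_cancel, hM, hM',
    ceil_int_add_binaryTail hA]
  by_cases hk : k + 1 ∈ A <;> simp [hk] <;> omega

/-- Binary digits can be prescribed, from some index on, inside any nonempty open interval. -/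
lemma exists_mem_Ioo_digitOneSet {A : Set ℕ} (hA : A.Infinite) {a b : ℝ} (hab : a < b) :
    ∃ ω ∈ Ioo a b, ∃ n, ∀ k > n, k ∈ digitOneSet ω ↔ k ∈ A := by
  obtain ⟨n, hn⟩ := pow_unbounded_of_one_lt (2 / (b - a)) one_lt_two
  rw [div_lt_iff₀ (sub_pos.2 hab)] at hn
  have h2 : (0 : ℝ) < 2 ^ n := by positivity
  have hω : 2 ^ n * ((⌈2 ^ n * a⌉ + binaryTail A n) / 2 ^ n) = ⌈2 ^ n * a⌉ + binaryTail A n :=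
    mul_div_cancel₀ _ h2.ne'
  refine ⟨_, ⟨?_, ?_⟩, n, fun k hk => mem_digitOneSet_iff_of_gt hA hω hk⟩
  · rw [lt_div_iff₀ h2]
    linarith [Int.le_ceil (2 ^ n * a), binaryTail_pos hA n]
  · rw [div_lt_iff₀ h2]
    linarith [Int.ceil_lt_add_one (2 ^ n * a), binaryTail_le_one A n]

lemma IsLimitPt.infinite_setOf_abs_sub_le {x : ℕ → ℝ} {ℓ : ℝ} (h : IsLimitPt x ℓ) {ε : ℝ}
    (hε : 0 < ε) : {n | |x n - ℓ| ≤ ε}.Infinite := by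
  obtain ⟨φ, hφ, hlim⟩ := h
  have hev : ∀ᶠ k in atTop, |x (φ k) - ℓ| ≤ ε :=
    hlim.eventually (Metric.closedBall_mem_nhds ℓ hε)
  exact Nat.frequently_atTop_iff_infinite.1 (hφ.tendsto_atTop.frequently hev.frequently)

/-- If `ℓ` is an ordinary limit point of `x`, then for every nonempty interval
`I = (a,b) ⊆ (0,1]` and every `m ≥ 1` there is `ω₀ ∈ I` with
`q_{ω₀,m}(N) ≥ 1/2` for all sufficiently large `N`. -/
theorem stmt7 (x : ℕ → ℝ) (ℓ : ℝ) (h : IsLimitPt x ℓ) (a b : ℝ) (hab : a < b)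
    (hI : Set.Ioo a b ⊆ Set.Ioc (0 : ℝ) 1) (m : ℕ) (hm : 1 ≤ m) :
    ∃ ω₀ ∈ Set.Ioo a b, ∀ᶠ N in Filter.atTop, (1 : ℝ) / 2 ≤ qdens x ℓ ω₀ m N := by
  have hA := h.infinite_setOf_abs_sub_le (ε := 1 / m) (by positivity)
  obtain ⟨ω, hω, n, hn⟩ := exists_mem_Ioo_digitOneSet hA hab
  have hinf : (Set.ofPred fun k => k ∈ digitOneSet ω).Infinite := by
    refine infinite_of_forall_exists_gt fun j => ?_
    obtain ⟨k, hk, hjk⟩ := hA.exists_gt (max n j)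
    exact ⟨k, (hn k (by omega)).2 hk, by omega⟩
  refine ⟨ω, hω, ?_⟩
  filter_upwards [eventually_ge_atTop (2 * (n + 1))] with N hN
  have hsub : Finset.Ico (n + 1) N ⊆
      (Finset.range N).filter (fun i => |subseq x ω i - ℓ| ≤ 1 / m) := by
    intro i hi
    rw [Finset.mem_Ico] at hi
    refine Finset.mem_filter.2 ⟨Finset.mem_range.2 hi.2, ?_⟩
    have hle := (Nat.nth_strictMono hinf).le_apply (x := i)
    exact (hn _ (by omega)).1 (Nat.nth_mem_of_infinite hinf i)
  have hcard := Finset.card_le_card hsub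
  rw [Nat.card_Ico] at hcard
  have hN0 : (0 : ℝ) < N := by exact_mod_cast (by omega : 0 < N)
  rw [qdens, le_div_iff₀ hN0]
  have h2 : N ≤ 2 * ((Finset.range N).filter (fun i => |subseq x ω i - ℓ| ≤ 1 / m)).card := by
    omega
  have h3 : (N : ℝ) ≤
      2 * ((Finset.range N).filter (fun i => |subseq x ω i - ℓ| ≤ 1 / m)).card := by
    exact_mod_cast h2
  linarith
end
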